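/- DAMI(2,2)(3) is a dual-affine invariant of 2D vector fields: with central moments u_{pqrs} of the object (Ω, f) and u*_{pqrs} of the transformed object (Ω*, f*) under any unimodular dual-affine transformation (A_M, A_N ∈ SL(2,ℝ), translations b, c ∈ ℝ²), one has u*_{0501}·u*_{5010} − u*_{0510}·u*_{5001} − 5·u*_{1401}·u*_{4110} + 5·u*_{1410}·u*_{4101} + 10·u*_{2301}·u*_{3210} − 10·u*_{2310}·u*_{3201} = u_{0501}·u_{5010} − u_{0510}·u_{5001} − 5·u_{1401}·u_{4110} + 5·u_{1410}·u_{4101} + 10·u_{2301}·u_{3210} − 10·u_{2310}·u_{3201}. -/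

import Mathlib

open MeasureTheory

/-- Centroid `(x̄, ȳ) = V⁻¹ ∫_Ω (x,y) dxdy` of a bounded set `Ω ⊂ ℝ²`. -/
noncomputable def centroid2 (Ω : Set (Fin 2 → ℝ)) : Fin 2 → ℝ :=
  (volume Ω).toReal⁻¹ • ∫ x in Ω, x

/-- Mean `(f̄₁, f̄₂) = V⁻¹ ∫_Ω f dxdy` of a 2D vector field over `Ω`. -/
noncomputable def meanField2 (Ω : Set (Fin 2 → ℝ))
    (f : (Fin 2 → ℝ) → (Fin 2 → ℝ)) : Fin 2 → ℝ :=
  (volume Ω).toReal⁻¹ • ∫ x in Ω, f x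

/-- Central moment
`u_{pqrs} = ∫_Ω (x − x̄)^p (y − ȳ)^q (f₁ − f̄₁)^r (f₂ − f̄₂)^s dxdy`. -/
noncomputable def u (Ω : Set (Fin 2 → ℝ)) (f : (Fin 2 → ℝ) → (Fin 2 → ℝ))
    (p q r s : ℕ) : ℝ :=
  ∫ x in Ω, (x 0 - centroid2 Ω 0) ^ p * (x 1 - centroid2 Ω 1) ^ q *
    (f x 0 - meanField2 Ω f 0) ^ r * (f x 1 - meanField2 Ω f 1) ^ s

/-- The transformed domain `Ω* = {A_M x + b : x ∈ Ω}`. -/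
def domStar (A_M : Matrix.SpecialLinearGroup (Fin 2) ℝ) (b : Fin 2 → ℝ)
    (Ω : Set (Fin 2 → ℝ)) : Set (Fin 2 → ℝ) :=
  (fun x => (A_M : Matrix (Fin 2) (Fin 2) ℝ).mulVec x + b) '' Ω

/-- The transformed vector field `f*(x) = A_N·f(A_M⁻¹(x − b)) + c`. -/
noncomputable def fieldStar (A_M A_N : Matrix.SpecialLinearGroup (Fin 2) ℝ)
    (b c : Fin 2 → ℝ) (f : (Fin 2 → ℝ) → (Fin 2 → ℝ)) :
    (Fin 2 → ℝ) → (Fin 2 → ℝ) :=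
  fun x => (A_N : Matrix (Fin 2) (Fin 2) ℝ).mulVec
      (f ((A_M⁻¹ : Matrix.SpecialLinearGroup (Fin 2) ℝ).1.mulVec (x - b))) + c

/-- Essentially bounded functions are closed under powers. -/
theorem memLp_top_pow {α : Type*} [MeasurableSpace α] {μ : Measure α} {X : α → ℝ}
    (hX : MemLp X ⊤ μ) (n : ℕ) : MemLp (fun x => X x ^ n) ⊤ μ := by
  induction n with
  | zero => simpa using memLp_top_const (1 : ℝ)
  | succ n ih => simpa only [pow_succ] using hX.mul' (r := ⊤) ih

theorem integrable_monomial {α : Type*} [MeasurableSpace α] {μ : Measure α} [IsFiniteMeasure μ]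
    {X Y F G : α → ℝ} (hX : MemLp X ⊤ μ) (hY : MemLp Y ⊤ μ) (hF : MemLp F ⊤ μ)
    (hG : MemLp G ⊤ μ) (p q r s : ℕ) :
    Integrable (fun x => X x ^ p * Y x ^ q * F x ^ r * G x ^ s) μ := by
  have h1 := (memLp_top_pow hY q).mul' (r := ⊤) (memLp_top_pow hX p)
  have h2 := (memLp_top_pow hF r).mul' (r := ⊤) h1
  have h3 := (memLp_top_pow hG s).mul' (r := ⊤) h2
  exact h3.integrable le_top

/-- Twice the moment polynomial is a double integral of a product of `2 × 2` determinants. -/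
theorem two_mul_dami_eq_integral {α : Type*} [MeasurableSpace α] {μ : Measure α}
    [IsFiniteMeasure μ] {X Y F G : α → ℝ} (hX : MemLp X ⊤ μ) (hY : MemLp Y ⊤ μ)
    (hF : MemLp F ⊤ μ) (hG : MemLp G ⊤ μ) (v : ℕ → ℕ → ℕ → ℕ → ℝ)
    (hv : ∀ p q r s, v p q r s = ∫ x, X x ^ p * Y x ^ q * F x ^ r * G x ^ s ∂μ) :
    2 * (v 0 5 0 1 * v 5 0 1 0 - v 0 5 1 0 * v 5 0 0 1 -
        5 * v 1 4 0 1 * v 4 1 1 0 + 5 * v 1 4 1 0 * v 4 1 0 1 +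
        10 * v 2 3 0 1 * v 3 2 1 0 - 10 * v 2 3 1 0 * v 3 2 0 1) =
      ∫ z : α × α, (Y z.1 * X z.2 - X z.1 * Y z.2) ^ 5 *
        (G z.1 * F z.2 - F z.1 * G z.2) ∂(μ.prod μ) := by
  set m : ℕ → ℕ → ℕ → ℕ → α → ℝ := fun p q r s x => X x ^ p * Y x ^ q * F x ^ r * G x ^ s
    with hm
  have hi : ∀ k p q r s p' q' r' s', Integrable
      (fun z : α × α => k * (m p q r s z.1 * m p' q' r' s' z.2)) (μ.prod μ) :=
    fun k p q r s p' q' r' s' => ((integrable_monomial hX hY hF hG p q r s).mul_prod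
      (integrable_monomial hX hY hF hG p' q' r' s')).const_mul k
  have he : ∀ k p q r s p' q' r' s',
      ∫ z : α × α, k * (m p q r s z.1 * m p' q' r' s' z.2) ∂(μ.prod μ) =
        k * (v p q r s * v p' q' r' s') := fun k p q r s p' q' r' s' => by
    rw [integral_const_mul, integral_prod_mul, hv, hv]
  let c : Fin 6 → ℝ := ![1, -5, 10, -10, 5, -1]
  have key : ∀ z : α × α, (Y z.1 * X z.2 - X z.1 * Y z.2) ^ 5 *
      (G z.1 * F z.2 - F z.1 * G z.2) =
      ∑ i : Fin 6, (c i * (m i (5 - i) 0 1 z.1 * m (5 - i) i 1 0 z.2) +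
        -c i * (m i (5 - i) 1 0 z.1 * m (5 - i) i 0 1 z.2)) := fun z => by
    simp [Fin.sum_univ_succ, c, hm]
    ring
  simp_rw [key]
  have hadd : ∀ i : Fin 6, _ := fun i => integral_add (hi (c i) i (5 - i) 0 1 (5 - i) i 1 0)
    (hi (-c i) i (5 - i) 1 0 (5 - i) i 0 1)
  rw [integral_finsetSum]
  · simp_rw [hadd, he]
    simp [Fin.sum_univ_succ, c]
    ring
  · exact fun i _ => (hi _ _ _ _ _ _ _ _ _).add (hi _ _ _ _ _ _ _ _ _)

/-- Unimodular affine maps preserve Lebesgue measure. -/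
theorem measurePreserving_unimodular (A : Matrix.SpecialLinearGroup (Fin 2) ℝ) (b : Fin 2 → ℝ) :
    MeasurePreserving (fun x : Fin 2 → ℝ => A.1.mulVec x + b) := by
  have hA : MeasurePreserving (Matrix.toLin' A.1) := by
    refine ⟨(Matrix.toLin' A.1).continuous_of_finiteDimensional.measurable, ?_⟩
    rw [Real.map_matrix_volume_pi_eq_smul_volume_pi (by simp)]
    simp
  exact (measurePreserving_add_right volume b).comp hA

theorem inv_mulVec_mulVec (A : Matrix.SpecialLinearGroup (Fin 2) ℝ) (x : Fin 2 → ℝ) :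
    (A⁻¹).1.mulVec (A.1.mulVec x) = x := by
  rw [Matrix.mulVec_mulVec, ← Matrix.SpecialLinearGroup.coe_mul, inv_mul_cancel]
  simp

theorem measurableEmbedding_unimodular (A : Matrix.SpecialLinearGroup (Fin 2) ℝ)
    (b : Fin 2 → ℝ) : MeasurableEmbedding (fun x : Fin 2 → ℝ => A.1.mulVec x + b) :=
  Continuous.measurableEmbedding (by fun_prop) fun x y h => by
    have := congrArg (A⁻¹).1.mulVec (add_right_cancel h)
    simpa only [inv_mulVec_mulVec] using this

theorem setIntegral_domStar {E : Type*} [NormedAddCommGroup E] [NormedSpace ℝ E]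
    (A : Matrix.SpecialLinearGroup (Fin 2) ℝ) (b : Fin 2 → ℝ) (Ω : Set (Fin 2 → ℝ))
    (g : (Fin 2 → ℝ) → E) :
    ∫ x in domStar A b Ω, g x = ∫ x in Ω, g (A.1.mulVec x + b) :=
  (measurePreserving_unimodular A b).setIntegral_image_emb
    (measurableEmbedding_unimodular A b) g Ω

theorem volume_domStar (A : Matrix.SpecialLinearGroup (Fin 2) ℝ) (b : Fin 2 → ℝ)
    (Ω : Set (Fin 2 → ℝ)) : volume (domStar A b Ω) = volume Ω := by
  have hemb := measurableEmbedding_unimodular A b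
  rw [← (measurePreserving_unimodular A b).measure_preimage_emb hemb, domStar,
    Set.preimage_image_eq _ hemb.injective]

theorem fieldStar_apply (A N : Matrix.SpecialLinearGroup (Fin 2) ℝ) (b c : Fin 2 → ℝ)
    (f : (Fin 2 → ℝ) → (Fin 2 → ℝ)) (x : Fin 2 → ℝ) :
    fieldStar A N b c f (A.1.mulVec x + b) = N.1.mulVec (f x) + c := by
  simp only [fieldStar, add_sub_cancel_right, inv_mulVec_mulVec]

/-- Averages commute with affine maps. -/
theorem average_mulVec_add {Ω : Set (Fin 2 → ℝ)} (hV : 0 < (volume Ω).toReal)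
    {g : (Fin 2 → ℝ) → (Fin 2 → ℝ)} (hg : IntegrableOn g Ω)
    (A : Matrix (Fin 2) (Fin 2) ℝ) (b : Fin 2 → ℝ) :
    (volume Ω).toReal⁻¹ • ∫ x in Ω, (A.mulVec (g x) + b) =
      A.mulVec ((volume Ω).toReal⁻¹ • ∫ x in Ω, g x) + b := by
  have hfin : volume Ω ≠ ⊤ := fun h => by simp [h] at hV
  let L : (Fin 2 → ℝ) →L[ℝ] (Fin 2 → ℝ) := LinearMap.toContinuousLinearMap A.mulVecLin
  have h1 : ∫ x in Ω, A.mulVec (g x) = A.mulVec (∫ x in Ω, g x) := L.integral_comp_comm hg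
  have h2 : IntegrableOn (fun x => A.mulVec (g x)) Ω := L.integrable_comp hg
  rw [integral_add h2 (integrableOn_const hfin), h1, setIntegral_const, smul_add,
    Matrix.mulVec_smul, smul_smul, measureReal_def, inv_mul_cancel₀ hV.ne', one_smul]

theorem centroid2_domStar {Ω : Set (Fin 2 → ℝ)} (hV : 0 < (volume Ω).toReal)
    (hg : IntegrableOn (fun x : Fin 2 → ℝ => x) Ω)
    (A : Matrix.SpecialLinearGroup (Fin 2) ℝ) (b : Fin 2 → ℝ) :
    centroid2 (domStar A b Ω) = A.1.mulVec (centroid2 Ω) + b := by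
  rw [centroid2, setIntegral_domStar, volume_domStar, average_mulVec_add hV hg, centroid2]

theorem meanField2_fieldStar {Ω : Set (Fin 2 → ℝ)} (hV : 0 < (volume Ω).toReal)
    {f : (Fin 2 → ℝ) → (Fin 2 → ℝ)} (hf : IntegrableOn f Ω)
    (A N : Matrix.SpecialLinearGroup (Fin 2) ℝ) (b c : Fin 2 → ℝ) :
    meanField2 (domStar A b Ω) (fieldStar A N b c f) = N.1.mulVec (meanField2 Ω f) + c := by
  rw [meanField2, setIntegral_domStar, volume_domStar]
  simp_rw [fieldStar_apply]
  rw [average_mulVec_add hV hf, meanField2]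

/-- The central moments of the transformed object as integrals over the original domain. -/
theorem u_domStar_fieldStar {Ω : Set (Fin 2 → ℝ)} (hV : 0 < (volume Ω).toReal)
    (hg : IntegrableOn (fun x : Fin 2 → ℝ => x) Ω)
    {f : (Fin 2 → ℝ) → (Fin 2 → ℝ)} (hf : IntegrableOn f Ω)
    (A N : Matrix.SpecialLinearGroup (Fin 2) ℝ) (b c : Fin 2 → ℝ) (p q r s : ℕ) :
    u (domStar A b Ω) (fieldStar A N b c f) p q r s =
      ∫ x in Ω, A.1.mulVec (x - centroid2 Ω) 0 ^ p * A.1.mulVec (x - centroid2 Ω) 1 ^ q *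
        N.1.mulVec (f x - meanField2 Ω f) 0 ^ r * N.1.mulVec (f x - meanField2 Ω f) 1 ^ s := by
  rw [u, setIntegral_domStar, centroid2_domStar hV hg, meanField2_fieldStar hV hf]
  simp_rw [fieldStar_apply, Matrix.mulVec_sub, Pi.sub_apply, Pi.add_apply, add_sub_add_right_eq_sub]

theorem memLp_top_mulVec {α : Type*} [MeasurableSpace α] {μ : Measure α} {g : α → Fin 2 → ℝ}
    (hg : MemLp g ⊤ μ) (A : Matrix (Fin 2) (Fin 2) ℝ) (i : Fin 2) :
    MemLp (fun x => A.mulVec (g x) i) ⊤ μ := by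
  let L : (Fin 2 → ℝ) →L[ℝ] ℝ :=
    LinearMap.toContinuousLinearMap (LinearMap.proj i ∘ₗ A.mulVecLin)
  exact L.comp_memLp' hg

/-- A unimodular matrix preserves the determinant of two vectors. -/
theorem det_mulVec_mulVec (A : Matrix.SpecialLinearGroup (Fin 2) ℝ) (v w : Fin 2 → ℝ) :
    A.1.mulVec v 1 * A.1.mulVec w 0 - A.1.mulVec v 0 * A.1.mulVec w 1 =
      v 1 * w 0 - v 0 * w 1 := by
  have h := A.2
  rw [Matrix.det_fin_two] at h
  simp only [Matrix.mulVec, dotProduct, Fin.sum_univ_two]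
  linear_combination (v 1 * w 0 - v 0 * w 1) * h

/-- DAMI(2,2)(three) is a dual-affine invariant of 2D vector fields
under any unimodular dual-affine transformation. -/
theorem dami22_three (Ω : Set (Fin 2 → ℝ))
    (hΩm : MeasurableSet Ω) (hΩb : Bornology.IsBounded Ω)
    (hV : 0 < (volume Ω).toReal)
    (f : (Fin 2 → ℝ) → (Fin 2 → ℝ)) (hfm : Measurable f)
    (hfb : ∃ C : ℝ, ∀ x, ‖f x‖ ≤ C)
    (A_M A_N : Matrix.SpecialLinearGroup (Fin 2) ℝ) (b c : Fin 2 → ℝ) :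
    (let v := u (domStar A_M b Ω) (fieldStar A_M A_N b c f);
      v 0 5 0 1 * v 5 0 1 0 - v 0 5 1 0 * v 5 0 0 1 -
        5 * v 1 4 0 1 * v 4 1 1 0 + 5 * v 1 4 1 0 * v 4 1 0 1 +
        10 * v 2 3 0 1 * v 3 2 1 0 - 10 * v 2 3 1 0 * v 3 2 0 1)
      =
    (let v := u Ω f;
      v 0 5 0 1 * v 5 0 1 0 - v 0 5 1 0 * v 5 0 0 1 -
        5 * v 1 4 0 1 * v 4 1 1 0 + 5 * v 1 4 1 0 * v 4 1 0 1 +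
        10 * v 2 3 0 1 * v 3 2 1 0 - 10 * v 2 3 1 0 * v 3 2 0 1) := by
  have : IsFiniteMeasure (volume.restrict Ω) :=
    ⟨by simpa using hΩb.measure_lt_top⟩
  obtain ⟨C, hC⟩ := hfb
  obtain ⟨R, hR⟩ := hΩb.exists_norm_le
  have hf : MemLp f ⊤ (volume.restrict Ω) :=
    memLp_top_of_bound hfm.aestronglyMeasurable C (.of_forall hC)
  have hx : MemLp (fun x : Fin 2 → ℝ => x) ⊤ (volume.restrict Ω) :=
    memLp_top_of_bound measurable_id.aestronglyMeasurable R
      ((ae_restrict_mem hΩm).mono fun x hx => hR x hx)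
  have hf' := hf.sub (memLp_top_const (meanField2 Ω f))
  have hx' := hx.sub (memLp_top_const (centroid2 Ω))
  have h1 := two_mul_dami_eq_integral (memLp_top_mulVec hx' A_M.1 0)
    (memLp_top_mulVec hx' A_M.1 1) (memLp_top_mulVec hf' A_N.1 0) (memLp_top_mulVec hf' A_N.1 1)
    (u (domStar A_M b Ω) (fieldStar A_M A_N b c f))
    (u_domStar_fieldStar hV (hx.integrable le_top) (hf.integrable le_top) A_M A_N b c)
  have h2 := two_mul_dami_eq_integral (hx'.eval 0) (hx'.eval 1) (hf'.eval 0) (hf'.eval 1)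
    (u Ω f) (fun _ _ _ _ => rfl)
  simp_rw [det_mulVec_mulVec] at h1
  exact mul_left_cancel₀ two_ne_zero (h1.trans h2.symm)
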